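/- Let G be a gyrogroup. Then L(G) = {L_a : a∈G} is a twisted subgroup of the left multiplication group LMlt(G): the identity permutation lies in L(G); if σ ∈ L(G) then σ⁻¹ ∈ L(G); and if σ, τ ∈ L(G) then σ∘τ∘σ ∈ L(G). (Indeed L_a⁻¹ = L_{⊖a} and L_a∘L_b∘L_a = L_{(a⊕b)⊞a}, where a⊞b = a⊕gyr[a,⊖b]b.) -/

import Mathlib

universe u v

/-- A gyrogroup: a groupoid `(G, +)` with a left identity `0`, left inverses `-a`,
gyroautomorphisms `gyr a b` (automorphisms of `(G, +)`) satisfying the left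
gyroassociative law, and the left loop property. -/
class Gyrogroup (G : Type u) extends Add G, Zero G, Neg G where
  /-- (G1) left identity -/
  zero_add' : ∀ a : G, 0 + a = a
  /-- (G2) left inverse -/
  neg_add' : ∀ a : G, -a + a = 0
  /-- (G3) the gyroautomorphisms, as bijections of `G` -/
  gyr : G → G → G ≃ G
  /-- (G3) each `gyr a b` preserves the operation, i.e. is an automorphism -/
  gyr_add' : ∀ a b x y : G, gyr a b (x + y) = gyr a b x + gyr a b y
  /-- (G3) left gyroassociative law -/
  add_gyr_assoc' : ∀ a b c : G, a + (b + c) = (a + b) + gyr a b c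
  /-- (G4) left loop property -/
  left_loop' : ∀ a b : G, gyr (a + b) b = gyr a b

open Gyrogroup

variable {G : Type u}

/-- A subgyrogroup: a nonempty subset closed under the operation and inverses. -/
structure IsSubgyrogroup [Gyrogroup G] (H : Set G) : Prop where
  nonempty : H.Nonempty
  add_mem : ∀ ⦃a : G⦄, a ∈ H → ∀ ⦃b : G⦄, b ∈ H → a + b ∈ H
  neg_mem : ∀ ⦃a : G⦄, a ∈ H → -a ∈ H

/-- A gyrogroup homomorphism: a map preserving the operation. -/
def IsGyroHom [Gyrogroup G] {A : Type v} [Gyrogroup A] (φ : G → A) : Prop :=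
  ∀ x y : G, φ (x + y) = φ x + φ y

/-- The kernel of a map into a gyrogroup. -/
def gyroKer [Gyrogroup G] {A : Type v} [Gyrogroup A] (φ : G → A) : Set G :=
  {x : G | φ x = 0}

/-- A normal subgyrogroup: the kernel of some gyrogroup homomorphism from `G`. -/
def IsNormalSubgyrogroup [Gyrogroup G] (N : Set G) : Prop :=
  IsSubgyrogroup N ∧ ∃ (A : Type u) (instA : Gyrogroup A) (φ : G → A),
    @IsGyroHom G _ A instA φ ∧ N = @gyroKer G _ A instA φ

/-- The gyrocommutator `[a, b] = -(a + b) + gyr a b (b + a)`. -/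
def gyroCommutator [Gyrogroup G] (a b : G) : G :=
  -(a + b) + gyr a b (b + a)

/-- The set of all gyrocommutators of `G`. -/
def gyroCommutatorSet (G : Type u) [Gyrogroup G] : Set G :=
  {x : G | ∃ a b : G, x = gyroCommutator a b}

/-- `K` is the commutator subgyrogroup `G'` of `G`: the smallest subgyrogroup
containing all commutators. -/
def IsCommutatorSubgyrogroup [Gyrogroup G] (K : Set G) : Prop :=
  IsSubgyrogroup K ∧ gyroCommutatorSet G ⊆ K ∧
    ∀ H : Set G, IsSubgyrogroup H → gyroCommutatorSet G ⊆ H → K ⊆ H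

/-- `K` is the normal closure `⟨⟨A⟩⟩` of `A`: the smallest normal subgyrogroup
containing `A`. -/
def IsGyroNormalClosure [Gyrogroup G] (A K : Set G) : Prop :=
  IsNormalSubgyrogroup K ∧ A ⊆ K ∧
    ∀ N : Set G, IsNormalSubgyrogroup N → A ⊆ N → K ⊆ N

/-- The left coset `a ⊕ H`. -/
def lcoset [Gyrogroup G] (a : G) (H : Set G) : Set G := (a + ·) '' H

/-- The right coset `H ⊕ a`. -/
def rcoset [Gyrogroup G] (H : Set G) (a : G) : Set G := (· + a) '' H

/-- A gyrogroup is gyrocommutative if `a + b = gyr a b (b + a)` for all `a, b`. -/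
def IsGyrocommutative (G : Type u) [Gyrogroup G] : Prop :=
  ∀ a b : G, a + b = gyr a b (b + a)

/-- An L-subgyrogroup: a subgyrogroup with `gyr a h (H) = H` for all `a ∈ G`, `h ∈ H`. -/
def IsLSubgyrogroup [Gyrogroup G] (H : Set G) : Prop :=
  IsSubgyrogroup H ∧ ∀ a : G, ∀ h ∈ H, ⇑(gyr a h) '' H = H

/-- A subgroup of a gyrogroup: a subgyrogroup that forms a group under the gyrogroup
operation (equivalently, on which the operation is associative; together with the
closure properties and the identity and inverses inherited from `G`, this makes it
a group). -/
def IsSubgroupOfGyrogroup [Gyrogroup G] (H : Set G) : Prop :=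
  IsSubgyrogroup H ∧ ∀ a ∈ H, ∀ b ∈ H, ∀ c ∈ H, a + (b + c) = (a + b) + c

/-- The left nucleus of `G`. -/
def leftNucleus (G : Type u) [Gyrogroup G] : Set G :=
  {a : G | ∀ b c : G, a + (b + c) = (a + b) + c}

/-- The middle nucleus of `G`. -/
def middleNucleus (G : Type u) [Gyrogroup G] : Set G :=
  {b : G | ∀ a c : G, a + (b + c) = (a + b) + c}

/-- The right nucleus of `G`. -/
def rightNucleus (G : Type u) [Gyrogroup G] : Set G :=
  {c : G | ∀ a b : G, a + (b + c) = (a + b) + c}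

/-- `L(G)`: the set of left gyrotranslations of `G`, viewed as permutations of `G`.
A permutation `σ` is a left gyrotranslation when `σ x = a + x` for some fixed `a`. -/
def LSet (G : Type u) [Gyrogroup G] : Set (Equiv.Perm G) :=
  {σ : Equiv.Perm G | ∃ a : G, ∀ x : G, σ x = a + x}

/-- `L(H)` for a subset `H ⊆ G`: the left gyrotranslations by elements of `H`. -/
def LSetOf [Gyrogroup G] (H : Set G) : Set (Equiv.Perm G) :=
  {σ : Equiv.Perm G | ∃ a ∈ H, ∀ x : G, σ x = a + x}

/-- The left multiplication group `LMlt(G)`: the subgroup of `Sym(G)` generated by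
the left gyrotranslations. -/
def LMlt (G : Type u) [Gyrogroup G] : Subgroup (Equiv.Perm G) :=
  Subgroup.closure (LSet G)

/-- `L(G)'`: the set of products `L_{a₁} ∘ ⋯ ∘ L_{aₙ}` of left gyrotranslations whose
reversed product `L_{aₙ} ∘ ⋯ ∘ L_{a₁}` is the identity. -/
def LPrime (G : Type u) [Gyrogroup G] : Set (Equiv.Perm G) :=
  {σ : Equiv.Perm G | ∃ l : List (Equiv.Perm G),
    (∀ τ ∈ l, τ ∈ LSet G) ∧ σ = l.prod ∧ l.reverse.prod = 1}

/-- `L(G)^# = ⋂_{a ∈ G} L_a ∘ L(G)`. -/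
def LSharp (G : Type u) [Gyrogroup G] : Set (Equiv.Perm G) :=
  {σ : Equiv.Perm G | ∀ ρ ∈ LSet G, ∃ τ ∈ LSet G, σ = ρ * τ}

/-- The radical of `G`: elements whose left gyrotranslation lies in `L(G)'`. -/
def gyroRadical (G : Type u) [Gyrogroup G] : Set G :=
  {a : G | ∃ σ ∈ LPrime G, ∀ x : G, σ x = a + x}

/-- `X` is a normal subgroup of the subgroup `Γ` (as a subset of the ambient group). -/
def IsNormalSubgroupIn {M : Type v} [Group M] (Γ : Subgroup M) (X : Set M) : Prop :=
  X ⊆ (Γ : Set M) ∧ (1 : M) ∈ X ∧ (∀ σ ∈ X, σ⁻¹ ∈ X) ∧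
    (∀ σ ∈ X, ∀ τ ∈ X, σ * τ ∈ X) ∧ ∀ γ ∈ Γ, ∀ σ ∈ X, γ * σ * γ⁻¹ ∈ X

/-- The coaddition `a ⊞ b = a + gyr a (-b) b`. -/
def gyroCoadd [Gyrogroup G] (a b : G) : G := a + gyr a (-b) b

/-- Natural-number multiples: `0 • a = 0`, `(m+1) • a = a + m • a`. -/
def gyroNsmul [Gyrogroup G] : ℕ → G → G
  | 0, _ => 0
  | n + 1, a => a + gyroNsmul n a

/-- The index `[G : H]`: the number of left cosets of `H` in `G`. -/
noncomputable def gyroIndex [Gyrogroup G] (H : Set G) : ℕ :=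
  Set.ncard {S : Set G | ∃ a : G, S = lcoset a H}

namespace Gyrogroup

variable [Gyrogroup G]

theorem add_left_cancel' {a b c : G} (h : a + b = a + c) : b = c := by
  have h' : -a + (a + b) = -a + (a + c) := by rw [h]
  rw [add_gyr_assoc', add_gyr_assoc', neg_add', zero_add', zero_add'] at h'
  exact (gyr (-a) a).injective h'

theorem gyr_zero_left (a x : G) : gyr 0 a x = x := by
  have h := add_gyr_assoc' 0 a x
  rw [zero_add', zero_add'] at h
  exact (add_left_cancel' h).symm

theorem neg_add_cancel_left' (a x : G) : -a + (a + x) = x := by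
  rw [add_gyr_assoc', neg_add', zero_add', ← left_loop', neg_add', gyr_zero_left]

theorem add_zero' (a : G) : a + 0 = a := by
  apply add_left_cancel' (a := -a)
  rw [neg_add_cancel_left', neg_add']

theorem neg_neg' (a : G) : - -a = a := by
  have h := neg_add_cancel_left' (-a) a
  rwa [neg_add', add_zero'] at h

theorem add_neg_cancel_left' (a x : G) : a + (-a + x) = x := by
  simpa only [neg_neg'] using neg_add_cancel_left' (-a) x

theorem add_neg' (a : G) : a + -a = 0 := by
  simpa only [neg_neg'] using neg_add' (-a)

theorem gyr_zero (a b : G) : gyr a b 0 = 0 := by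
  apply add_left_cancel' (a := gyr a b 0)
  rw [← gyr_add', zero_add', add_zero']

theorem gyr_neg (a b x : G) : gyr a b (-x) = -gyr a b x := by
  apply add_left_cancel' (a := gyr a b x)
  rw [← gyr_add', add_neg', add_neg', gyr_zero]

/-- The nested gyroautomorphism identity. -/
theorem gyr_neg_gyr_gyr (a b x : G) : gyr a (-gyr a b b) (gyr a b x) = x := by
  have hcancel : (a + b) + -gyr a b b = a := by
    rw [← gyr_neg, ← add_gyr_assoc', add_neg', add_zero']
  have h := left_loop' (a + b) (-gyr a b b)
  rw [hcancel] at h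
  rw [h]
  apply add_left_cancel' (a := a)
  rw [← gyr_neg] at hcancel ⊢
  conv_lhs => enter [1]; rw [← hcancel]
  rw [← add_gyr_assoc', ← gyr_add', ← add_gyr_assoc', add_neg_cancel_left']

/-- Right translations are surjective. -/
theorem exists_add_right_eq (b c : G) : ∃ x : G, x + b = c := by
  refine ⟨c + -gyr c b b, ?_⟩
  conv_lhs => enter [2]; rw [← gyr_neg_gyr_gyr c b b]
  rw [← add_gyr_assoc', neg_add', add_zero']

theorem gyr_neg_add_gyr (a b x : G) : gyr (-a) (a + b) (gyr a b x) = x := by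
  apply add_left_cancel' (a := b)
  conv_lhs => enter [1]; rw [← neg_add_cancel_left' a b]
  rw [← add_gyr_assoc', ← add_gyr_assoc', neg_add_cancel_left']

theorem gyr_gyr_swap (a b x : G) : gyr b a (gyr a b x) = x := by
  obtain ⟨c, rfl⟩ := exists_add_right_eq b a
  have h := left_loop' (-c) (c + b)
  rw [neg_add_cancel_left'] at h
  rw [h, left_loop', gyr_neg_add_gyr]

theorem gyr_add_neg (a b : G) : gyr (a + b) (-a) = gyr a b := by
  ext x
  apply (gyr (-a) (a + b)).injective
  rw [gyr_gyr_swap, gyr_neg_add_gyr]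

theorem add_add_add_eq_gyroCoadd_add (a b x : G) :
    a + (b + (a + x)) = gyroCoadd (a + b) a + x := by
  have h := gyr_neg_gyr_gyr (a + b) (-a) x
  rw [gyr_neg, neg_neg'] at h
  rw [add_gyr_assoc' a b, gyr_add', add_gyr_assoc', ← gyr_add_neg a b, h, gyroCoadd]

end Gyrogroup

/-- `L(G)` is a twisted subgroup of `LMlt(G)`: it contains the identity,
is closed under inverses, and closed under `(σ, τ) ↦ σ ∘ τ ∘ σ`; indeed
`L_a⁻¹ = L_{-a}` and `L_a ∘ L_b ∘ L_a = L_{(a+b) ⊞ a}`. -/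
theorem LSet_twisted_subgroup_of_LMlt (G : Type u) [Gyrogroup G] :
    (∀ σ ∈ LSet G, σ ∈ LMlt G) ∧
    (1 : Equiv.Perm G) ∈ LSet G ∧
    (∀ σ ∈ LSet G, σ⁻¹ ∈ LSet G) ∧
    (∀ σ ∈ LSet G, ∀ τ ∈ LSet G, σ * τ * σ ∈ LSet G) ∧
    (∀ (σ : Equiv.Perm G) (a : G), (∀ x : G, σ x = a + x) →
      ∀ x : G, σ⁻¹ x = -a + x) ∧
    (∀ (σ τ : Equiv.Perm G) (a b : G), (∀ x : G, σ x = a + x) →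
      (∀ x : G, τ x = b + x) →
      ∀ x : G, (σ * τ * σ) x = gyroCoadd (a + b) a + x) := by
  have hinv : ∀ (σ : Equiv.Perm G) (a : G), (∀ x : G, σ x = a + x) →
      ∀ x : G, σ⁻¹ x = -a + x := by
    intro σ a hσ x
    rw [Equiv.Perm.inv_eq_iff_eq, hσ, add_neg_cancel_left']
  have htwist : ∀ (σ τ : Equiv.Perm G) (a b : G), (∀ x : G, σ x = a + x) →
      (∀ x : G, τ x = b + x) →
      ∀ x : G, (σ * τ * σ) x = gyroCoadd (a + b) a + x := by
    intro σ τ a b hσ hτ x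
    rw [Equiv.Perm.mul_apply, Equiv.Perm.mul_apply, hσ, hτ, hσ, add_add_add_eq_gyroCoadd_add]
  refine ⟨fun σ hσ => Subgroup.subset_closure hσ, ⟨0, fun x => (zero_add' x).symm⟩, ?_, ?_,
    hinv, htwist⟩
  · rintro σ ⟨a, hσ⟩
    exact ⟨-a, hinv σ a hσ⟩
  · rintro σ ⟨a, hσ⟩ τ ⟨b, hτ⟩
    exact ⟨gyroCoadd (a + b) a, htwist σ τ a b hσ hτ⟩
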